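/- Let R be a commutative Noetherian ring, I_1,...,I_t ideals, M and N finitely generated R-modules, N' ⊆ N a submodule, and fix i ≥ 0. Then there exists k ∈ ℕ such that Ass_R(Ext_R^i(M, N/(I_1^{n_1}⋯I_t^{n_t}) N')) is the same set for all (n_1,...,n_t) with each n_j ≥ k. -/

import Mathlib

open CategoryTheory
open scoped TensorProduct

lemma Finsupp.induction_add_single {ι : Type*} {p : (n : ι →₀ ℕ) → Prop} (zero : p 0)
    (step : ∀ j n, p n → p (n + Finsupp.single j 1)) (n : ι →₀ ℕ) : p n := by
  induction n using Finsupp.induction with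
  | zero => exact zero
  | single_add j b f _ _ ih =>
    clear * - ih step
    induction b with
    | zero => simpa
    | succ b ihb =>
      have := step j _ ihb
      rwa [add_right_comm, ← Finsupp.single_add] at this

section Rees

variable {R : Type*} [CommRing R] {ι : Type*}

/-- The product `∏ j, I j ^ n j` of powers of a finite family of ideals. -/
def Ideal.multiPow [Fintype ι] (I : ι → Ideal R) (n : ι →₀ ℕ) : Ideal R := ∏ j, I j ^ n j

namespace Ideal

variable (I : ι → Ideal R)

/-- The multi-Rees algebra of a family of ideals, as a subalgebra of the polynomial ring. -/
noncomputable def multiRees : Subalgebra R (MvPolynomial ι R) :=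
  Algebra.adjoin R (⋃ j, MvPolynomial.monomial (Finsupp.single j 1) '' (I j : Set R))

lemma monomial_single_mem_multiRees {j : ι} {a : R} (ha : a ∈ I j) :
    MvPolynomial.monomial (Finsupp.single j 1) a ∈ multiRees I :=
  Algebra.subset_adjoin (Set.mem_iUnion.2 ⟨j, a, ha, rfl⟩)

variable [Fintype ι]

lemma multiPow_zero : multiPow I 0 = ⊤ := by
  simp [multiPow, one_eq_top]

lemma multiPow_add (n m : ι →₀ ℕ) : multiPow I (n + m) = multiPow I n * multiPow I m := by
  simp [multiPow, pow_add, Finset.prod_mul_distrib]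

lemma multiPow_single (j : ι) : multiPow I (Finsupp.single j 1) = I j := by
  classical
  rw [multiPow, Finset.prod_eq_single j] <;> simp +contextual

lemma monomial_mem_multiRees {n : ι →₀ ℕ} {a : R} (ha : a ∈ multiPow I n) :
    MvPolynomial.monomial n a ∈ multiRees I := by
  induction n using Finsupp.induction_add_single generalizing a with
  | zero => exact (multiRees I).algebraMap_mem a
  | step j n ih =>
    rw [multiPow_add, multiPow_single] at ha
    induction ha using Submodule.mul_induction_on' with
    | mem_mul_mem x hx y hy =>
      rw [← MvPolynomial.monomial_mul]
      exact mul_mem (ih hx) (monomial_single_mem_multiRees I hy)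
    | add x _ y _ hx hy =>
      rw [map_add]
      exact add_mem hx hy

lemma multiRees_fg [IsNoetherianRing R] : (multiRees I).FG := by
  choose G hG using fun j ↦ (isNoetherianRing_iff_ideal_fg R).1 ‹_› (I j)
  refine Subalgebra.fg_def.2
    ⟨⋃ j, MvPolynomial.monomial (Finsupp.single j 1) '' (G j : Set R),
      Set.finite_iUnion fun j ↦ (G j).finite_toSet.image _, ?_⟩
  refine le_antisymm (Algebra.adjoin_mono ?_) (Algebra.adjoin_le ?_)
  · refine Set.iUnion_mono fun j ↦ Set.image_mono ?_
    rw [← hG j]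
    exact Submodule.subset_span
  · refine Set.iUnion_subset fun j ↦ ?_
    rintro _ ⟨a, ha, rfl⟩
    rw [← hG j] at ha
    induction ha using Submodule.span_induction with
    | mem x hx => exact Algebra.subset_adjoin (Set.mem_iUnion.2 ⟨j, x, hx, rfl⟩)
    | zero => simp
    | add x y _ _ hx hy =>
      rw [map_add]
      exact add_mem hx hy
    | smul a x _ hx =>
      rw [map_smul]
      exact Subalgebra.smul_mem _ hx a

instance [IsNoetherianRing R] : IsNoetherianRing (multiRees I) :=
  isNoetherianRing_of_fg (multiRees_fg I)

end Ideal

end Rees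

section Coeff

variable {R : Type*} [CommRing R] {ι : Type*} {B : Type*} [AddCommGroup B] [Module R B]

/-- The `n`-th coefficient of an element of `R[X] ⊗ B`. -/
noncomputable def tensorCoeff (n : ι →₀ ℕ) : MvPolynomial ι R ⊗[R] B →ₗ[R] B :=
  TensorProduct.lid R B ∘ₗ (MvPolynomial.lcoeff R n).rTensor B

lemma tensorCoeff_tmul (n : ι →₀ ℕ) (f : MvPolynomial ι R) (b : B) :
    tensorCoeff n (f ⊗ₜ[R] b) = f.coeff n • b := by
  simp [tensorCoeff]

lemma tensorCoeff_monomial_smul_add (n m : ι →₀ ℕ) (a : R) (x : MvPolynomial ι R ⊗[R] B) :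
    tensorCoeff (n + m) (MvPolynomial.monomial m a • x) = a • tensorCoeff n x := by
  induction x with
  | zero => simp
  | tmul f b =>
    rw [TensorProduct.smul_tmul', tensorCoeff_tmul, tensorCoeff_tmul, smul_eq_mul, add_comm,
      MvPolynomial.coeff_monomial_mul, mul_smul]
  | add x y hx hy => simp only [smul_add, map_add, hx, hy]

lemma tensorCoeff_monomial_smul_of_not_le {n m : ι →₀ ℕ} (h : ¬ m ≤ n) (a : R)
    (x : MvPolynomial ι R ⊗[R] B) :
    tensorCoeff n (MvPolynomial.monomial m a • x) = 0 := by
  induction x with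
  | zero => simp
  | tmul f b =>
    rw [TensorProduct.smul_tmul', tensorCoeff_tmul, smul_eq_mul,
      MvPolynomial.coeff_monomial_mul', if_neg h, zero_smul]
  | add x y hx hy => simp only [smul_add, map_add, hx, hy, add_zero]

lemma exists_eq_sum_monomial_tmul (x : MvPolynomial ι R ⊗[R] B) :
    ∃ s : Finset (ι →₀ ℕ), ∀ t, s ⊆ t →
      x = ∑ n ∈ t, MvPolynomial.monomial n (1 : R) ⊗ₜ[R] tensorCoeff n x := by
  classical
  induction x with
  | zero => exact ⟨∅, by simp⟩
  | tmul f b =>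
    refine ⟨f.support, fun t ht ↦ ?_⟩
    have (n : ι →₀ ℕ) : MvPolynomial.monomial n (1 : R) ⊗ₜ[R] tensorCoeff n (f ⊗ₜ[R] b) =
        MvPolynomial.monomial n (f.coeff n) ⊗ₜ[R] b := by
      rw [tensorCoeff_tmul, TensorProduct.tmul_smul, TensorProduct.smul_tmul',
        MvPolynomial.smul_monomial, smul_eq_mul, mul_one]
    simp_rw [this, ← TensorProduct.sum_tmul]
    congr 1
    conv_lhs => rw [f.as_sum]
    exact Finset.sum_subset ht fun n _ hn ↦ by simp [MvPolynomial.notMem_support_iff.1 hn]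
  | add x y hx hy =>
    obtain ⟨s, hs⟩ := hx
    obtain ⟨s', hs'⟩ := hy
    refine ⟨s ∪ s', fun t ht ↦ ?_⟩
    simp_rw [map_add, TensorProduct.tmul_add, Finset.sum_add_distrib]
    rw [← hs t (Finset.union_subset_left ht), ← hs' t (Finset.union_subset_right ht)]

end Coeff

lemma Submodule.FG.exists_eq_of_monotone {S X : Type*} [CommRing S] [IsNoetherianRing S]
    [AddCommGroup X] [Module S X] {M : Submodule S X} (hM : M.FG) {α : Type*} [Preorder α]
    [Nonempty α] (T : α → Submodule S X) (hT : Monotone T) (hTM : ∀ k, T k ≤ M) :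
    ∃ k, ∀ k', k ≤ k' → T k' = T k := by
  have : Module.Finite S M := Module.Finite.iff_fg.2 hM
  obtain ⟨_, ⟨k, rfl⟩, hk⟩ := set_has_maximal_iff_noetherian.2 (inferInstance : IsNoetherian S M)
    (Set.range fun k ↦ (T k).submoduleOf M) (Set.range_nonempty _)
  refine ⟨k, fun k' h ↦ le_antisymm (fun x hx ↦ ?_) (hT h)⟩
  have heq : (T k).submoduleOf M = (T k').submoduleOf M :=
    (lt_or_eq_of_le (Submodule.comap_mono (hT h))).resolve_left (hk _ ⟨_, rfl⟩)
  have : (⟨x, hTM _ hx⟩ : M) ∈ (T k').submoduleOf M := hx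
  rw [← heq] at this
  exact this

section Filtration

open Ideal

variable {R : Type*} [CommRing R] {ι : Type*} {B : Type*} [AddCommGroup B] [Module R B]

/-- A multi-graded family of submodules on which `I j` acts with degree `single j 1`. -/
def IsMultiFiltration (I : ι → Ideal R) (F : (ι →₀ ℕ) → Submodule R B) : Prop :=
  ∀ j n, I j • F n ≤ F (n + Finsupp.single j 1)

namespace IsMultiFiltration

variable {I : ι → Ideal R} {F G : (ι →₀ ℕ) → Submodule R B}

/-- The submodule over the multi-Rees algebra associated to a family of submodules. -/
noncomputable def total (hF : IsMultiFiltration I F) :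
    Submodule (multiRees I) (MvPolynomial ι R ⊗[R] B) where
  carrier := {x | ∀ n, tensorCoeff n x ∈ F n}
  zero_mem' n := by simp
  add_mem' hx hy n := by
    rw [map_add]
    exact add_mem (hx n) (hy n)
  smul_mem' := by
    classical
    rintro ⟨f, hf⟩ x hx
    change ∀ n, tensorCoeff n (f • x) ∈ F n
    replace hx : ∀ n, tensorCoeff n x ∈ F n := hx
    induction hf using Algebra.adjoin_induction generalizing x with
    | mem f hf =>
      obtain ⟨j, a, ha, rfl⟩ := Set.mem_iUnion.1 hf
      intro n
      by_cases h : Finsupp.single j 1 ≤ n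
      · obtain ⟨m, rfl⟩ := exists_add_of_le h
        rw [add_comm, tensorCoeff_monomial_smul_add]
        exact hF j m (Submodule.smul_mem_smul ha (hx m))
      · rw [tensorCoeff_monomial_smul_of_not_le h]
        exact zero_mem _
    | algebraMap r =>
      intro n
      rw [algebraMap_smul, map_smul]
      exact Submodule.smul_mem _ _ (hx n)
    | add f g _ _ hf hg =>
      intro n
      rw [add_smul, map_add]
      exact add_mem (hf hx n) (hg hx n)
    | mul f g _ _ hf hg =>
      intro n
      rw [mul_smul]
      exact hf (hg hx) n

lemma mem_total (hF : IsMultiFiltration I F) {x : MvPolynomial ι R ⊗[R] B} :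
    x ∈ hF.total ↔ ∀ n, tensorCoeff n x ∈ F n := Iff.rfl

lemma monomial_tmul_mem_total_iff (hF : IsMultiFiltration I F) {n : ι →₀ ℕ} {b : B} :
    MvPolynomial.monomial n (1 : R) ⊗ₜ[R] b ∈ hF.total ↔ b ∈ F n := by
  classical
  simp only [mem_total, tensorCoeff_tmul, MvPolynomial.coeff_monomial, ite_smul, one_smul,
    zero_smul]
  refine ⟨fun h ↦ by simpa using h n, fun h m ↦ ?_⟩
  split_ifs with hm
  · exact hm ▸ h
  · exact zero_mem _

lemma total_mono (hF : IsMultiFiltration I F) (hG : IsMultiFiltration I G) (h : ∀ n, F n ≤ G n) :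
    hF.total ≤ hG.total :=
  fun _ hx n ↦ h n (hx n)

lemma le_of_total_le (hF : IsMultiFiltration I F) (hG : IsMultiFiltration I G)
    (h : hF.total ≤ hG.total) (n : ι →₀ ℕ) : F n ≤ G n :=
  fun _ hb ↦ hG.monomial_tmul_mem_total_iff.1 (h (hF.monomial_tmul_mem_total_iff.2 hb))

variable [Fintype ι]

lemma multiPow_smul_le (hF : IsMultiFiltration I F) (n m : ι →₀ ℕ) :
    multiPow I m • F n ≤ F (n + m) := by
  induction m using Finsupp.induction_add_single with
  | zero => simp [multiPow_zero]
  | step j m ih =>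
    rw [multiPow_add, multiPow_single, mul_comm, mul_smul, ← add_assoc]
    exact (smul_mono_right _ ih).trans (hF j _)

lemma multiPow (I : ι → Ideal R) (E : Submodule R B) :
    IsMultiFiltration I (fun n ↦ Ideal.multiPow I n • E) := fun j n ↦ by
  beta_reduce
  rw [multiPow_add, multiPow_single, mul_comm, mul_smul]

lemma total_multiPow_fg (I : ι → Ideal R) {E : Submodule R B} (hE : E.FG) :
    (multiPow I E).total.FG := by
  obtain ⟨S, rfl⟩ := hE
  classical
  refine ⟨S.image (fun e ↦ (1 : MvPolynomial ι R) ⊗ₜ[R] e), le_antisymm ?_ ?_⟩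
  · rw [Submodule.span_le, Finset.coe_image]
    rintro _ ⟨e, he, rfl⟩
    exact (multiPow I _).monomial_tmul_mem_total_iff.2 (by
      rw [multiPow_zero, Submodule.top_smul]
      exact Submodule.subset_span he)
  · intro x hx
    set T := Submodule.span (multiRees I)
      ((S.image (fun e ↦ (1 : MvPolynomial ι R) ⊗ₜ[R] e) : Finset _) :
        Set (MvPolynomial ι R ⊗[R] B)) with hT
    have h1 (e : B) (he : e ∈ Submodule.span R (S : Set B)) :
        (1 : MvPolynomial ι R) ⊗ₜ[R] e ∈ T := by
      induction he using Submodule.span_induction with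
      | mem e he => exact Submodule.subset_span (by simpa using ⟨e, he, rfl⟩)
      | zero => simp
      | add e e' _ _ h h' =>
        rw [TensorProduct.tmul_add]
        exact add_mem h h'
      | smul r e _ h =>
        rw [TensorProduct.tmul_smul]
        exact Submodule.smul_of_tower_mem _ r h
    have h2 (n : ι →₀ ℕ) (b : B) (hb : b ∈ Ideal.multiPow I n • Submodule.span R (S : Set B)) :
        MvPolynomial.monomial n (1 : R) ⊗ₜ[R] b ∈ T := by
      induction hb using Submodule.smul_induction_on' with
      | smul a ha e he =>
        have := T.smul_mem ⟨_, monomial_mem_multiRees I ha⟩ (h1 e he)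
        rw [Subalgebra.smul_def, TensorProduct.smul_tmul', smul_eq_mul, mul_one] at this
        rwa [TensorProduct.tmul_smul, TensorProduct.smul_tmul', MvPolynomial.smul_monomial,
          smul_eq_mul, mul_one]
      | add b _ b' _ h h' =>
        rw [TensorProduct.tmul_add]
        exact add_mem h h'
    obtain ⟨s, hs⟩ := exists_eq_sum_monomial_tmul x
    rw [hs s subset_rfl]
    exact sum_mem fun n _ ↦ h2 n _ (hx n)

/-- The filtration generated by the terms of degree at most `k` of a given filtration. -/
def truncation (I : ι → Ideal R) (F : (ι →₀ ℕ) → Submodule R B) (k n : ι →₀ ℕ) :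
    Submodule R B :=
  ⨆ (d : ι →₀ ℕ) (e : ι →₀ ℕ) (_ : d ≤ k) (_ : d + e = n), Ideal.multiPow I e • F d

lemma truncation_isMultiFiltration (k : ι →₀ ℕ) :
    IsMultiFiltration I (truncation I F k) := fun j n ↦ by
  simp only [truncation, Submodule.smul_iSup, iSup_le_iff]
  intro d e hd hn
  rw [← mul_smul, mul_comm, ← multiPow_single I j, ← multiPow_add]
  exact le_iSup₂_of_le d (e + Finsupp.single j 1)
    (le_iSup₂_of_le hd (by rw [← hn, add_assoc]) le_rfl)

lemma truncation_mono {k k' : ι →₀ ℕ} (h : k ≤ k') (n : ι →₀ ℕ) :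
    truncation I F k n ≤ truncation I F k' n := by
  simp only [truncation, iSup_le_iff]
  intro d e hd hn
  exact le_iSup₂_of_le d e (le_iSup₂_of_le (hd.trans h) hn le_rfl)

lemma truncation_le (hF : IsMultiFiltration I F) (k n : ι →₀ ℕ) : truncation I F k n ≤ F n := by
  simp only [truncation, iSup_le_iff]
  rintro d e - rfl
  exact hF.multiPow_smul_le d e

lemma le_truncation {k n : ι →₀ ℕ} (h : n ≤ k) : F n ≤ truncation I F k n :=
  le_iSup₂_of_le n 0 (le_iSup₂_of_le h (add_zero n)
    (by rw [multiPow_zero, Submodule.top_smul]))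

lemma truncation_add_le (hF : IsMultiFiltration I F) (k n : ι →₀ ℕ) :
    truncation I F k (k + n) ≤ Ideal.multiPow I n • F k := by
  simp only [truncation, iSup_le_iff]
  intro d e hd hn
  obtain ⟨c, rfl⟩ := exists_add_of_le hd
  obtain rfl : e = n + c := by
    rw [add_assoc] at hn
    rw [add_left_cancel hn, add_comm]
  rw [multiPow_add, mul_smul]
  exact smul_mono_right _ (hF.multiPow_smul_le d c)

/-- **Artin–Rees lemma** for several ideals. -/
theorem exists_le_multiPow_smul [IsNoetherianRing R] (hF : IsMultiFiltration I F)
    {E : Submodule R B} (hE : E.FG) (hFE : ∀ n, F n ≤ Ideal.multiPow I n • E) :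
    ∃ k, ∀ n, F (k + n) ≤ Ideal.multiPow I n • F k := by
  obtain ⟨k, hk⟩ := (total_multiPow_fg I hE).exists_eq_of_monotone
    (fun k ↦ (truncation_isMultiFiltration (I := I) (F := F) k).total)
    (fun k k' h ↦ total_mono _ _ (truncation_mono h))
    (fun k ↦ total_mono _ _ fun n ↦ (hF.truncation_le k n).trans (hFE n))
  exact ⟨k, fun n ↦ (le_truncation le_rfl).trans <|
    (le_of_total_le _ _ (hk _ le_self_add).le _).trans (hF.truncation_add_le k n)⟩

end IsMultiFiltration

/-- Artin–Rees for preimages under a linear map. -/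
theorem exists_comap_multiPow_smul_eq [IsNoetherianRing R] [Fintype ι] (I : ι → Ideal R)
    {G : Type*} [AddCommGroup G] [Module R G] (f : B →ₗ[R] G) {E : Submodule R G} (hE : E.FG) :
    ∃ k D, ∀ n, (multiPow I (k + n) • E).comap f = LinearMap.ker f ⊔ multiPow I n • D := by
  let F (n : ι →₀ ℕ) := (multiPow I n • E) ⊓ LinearMap.range f
  have hF : IsMultiFiltration I F := fun j n ↦
    le_inf ((smul_mono_right _ inf_le_left).trans (IsMultiFiltration.multiPow I E j n))
      (Submodule.smul_le_right.trans inf_le_right)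
  obtain ⟨k, hk⟩ := hF.exists_le_multiPow_smul hE fun _ ↦ inf_le_left
  refine ⟨k, (multiPow I k • E).comap f, fun n ↦ le_antisymm (fun x hx ↦ ?_) (sup_le ?_ ?_)⟩
  · have : f x ∈ (multiPow I n • (multiPow I k • E).comap f).map f := by
      rw [Submodule.map_smul'', Submodule.map_comap_eq, inf_comm]
      exact hk n ⟨hx, x, rfl⟩
    obtain ⟨y, hy, hyx⟩ := this
    rw [← sub_add_cancel x y]
    exact add_mem (Submodule.mem_sup_left (by simp [hyx])) (Submodule.mem_sup_right hy)
  · exact LinearMap.ker_le_comap f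
  · rw [← Submodule.map_le_iff_le_comap, Submodule.map_smul'', add_comm, multiPow_add, mul_smul]
    exact smul_mono_right _ (Submodule.map_comap_le _ _)

end Filtration

section Finiteness

variable {R : Type*} [CommRing R]

lemma finite_setOf_isPrime_forall_mem_iff_smul_eq_zero {S N : Type*} [CommRing S]
    [IsNoetherianRing S] [Algebra R S] [AddCommGroup N] [Module S N] [Module.Finite S N] :
    {P : Ideal R | P.IsPrime ∧ ∃ x : N, ∀ r, r ∈ P ↔ algebraMap R S r • x = 0}.Finite := by
  induction ‹Module.Finite S N› using
    IsNoetherianRing.induction_on_isQuotientEquivQuotientPrime S with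
  | subsingleton N =>
    convert Set.finite_empty
    refine Set.eq_empty_of_forall_notMem fun P ⟨hP, x, hx⟩ ↦ hP.one_notMem ?_
    exact (hx 1).2 (Subsingleton.elim _ _)
  | quotient N p f =>
    refine (Set.finite_singleton (p.1.comap (algebraMap R S))).subset ?_
    rintro P ⟨hP, x, hx⟩
    obtain ⟨s, hs⟩ := Ideal.Quotient.mk_surjective (f x)
    have hx' (r : R) : r ∈ P ↔ algebraMap R S r * s ∈ p.1 := by
      rw [hx, ← Ideal.Quotient.eq_zero_iff_mem, map_mul, hs, ← f.map_eq_zero_iff, map_smul]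
      rfl
    have hs' : s ∉ p.1 := fun h ↦ hP.one_notMem ((hx' 1).2 (Ideal.mul_mem_left _ _ h))
    ext r
    rw [hx', Ideal.mem_comap, p.2.mul_mem_iff_mem_or_mem, or_iff_left hs']
  | exact N₁ N₂ N₃ f g hf _ hfg h₁ h₃ =>
    refine (h₁.union h₃).subset ?_
    rintro P ⟨hP, x, hx⟩
    by_cases h : ∀ r, algebraMap R S r • g x = 0 → r ∈ P
    · exact Or.inr ⟨hP, g x, fun r ↦ ⟨fun hr ↦ by rw [← map_smul, (hx r).1 hr, map_zero], h r⟩⟩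
    · push Not at h
      obtain ⟨a, ha, haP⟩ := h
      rw [← map_smul] at ha
      obtain ⟨y, hy⟩ := (hfg _).1 ha
      refine Or.inl ⟨hP, y, fun r ↦ ?_⟩
      rw [← (map_eq_zero_iff f hf), map_smul, hy, ← mul_smul, ← map_mul, ← hx,
        hP.mul_mem_iff_mem_or_mem, or_iff_left haP]

lemma Submodule.FG.finite_setOf_isPrime_forall_mem_iff_smul_mem {S X : Type*} [CommRing S]
    [IsNoetherianRing S] [Algebra R S] [AddCommGroup X] [Module S X] [Module R X]
    [IsScalarTower R S X] {V : Submodule S X} (hV : V.FG) (U : Submodule S X) :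
    {P : Ideal R | P.IsPrime ∧ ∃ x ∈ V, ∀ r : R, r ∈ P ↔ r • x ∈ U}.Finite := by
  have : Module.Finite S (V.map U.mkQ) := Module.Finite.iff_fg.2 (hV.map _)
  refine (finite_setOf_isPrime_forall_mem_iff_smul_eq_zero
    (S := S) (N := V.map U.mkQ)).subset ?_
  rintro P ⟨hP, x, hx, h⟩
  refine ⟨hP, ⟨U.mkQ x, Submodule.mem_map_of_mem hx⟩, fun r ↦ ?_⟩
  rw [h, Subtype.ext_iff, Submodule.coe_smul, Submodule.coe_zero, ← map_smul,
    algebraMap_smul, Submodule.mkQ_apply, Submodule.Quotient.mk_eq_zero]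

variable [IsNoetherianRing R] {ι : Type*} [Fintype ι] {B : Type*} [AddCommGroup B] [Module R B]
  [Module.Finite R B]

/-- The modules `B ⧸ (∏ j, I j ^ n j) • E` have only finitely many associated primes altogether. -/
theorem finite_setOf_isPrime_forall_mem_iff_smul_mem_multiPow_smul (I : ι → Ideal R)
    (E : Submodule R B) :
    {P : Ideal R | P.IsPrime ∧
      ∃ (n : ι →₀ ℕ) (b : B), ∀ r : R, r ∈ P ↔ r • b ∈ Ideal.multiPow I n • E}.Finite := by
  have hE : E.FG := IsNoetherian.noetherian E
  have hshift (j : ι) : IsMultiFiltration I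
      (fun n ↦ Ideal.multiPow I (n + Finsupp.single j 1) • E) := fun i n ↦ by
    have := IsMultiFiltration.multiPow I E i (n + Finsupp.single j 1)
    rwa [add_right_comm] at this
  have hfin (j : ι) := (IsMultiFiltration.total_multiPow_fg I hE
    ).finite_setOf_isPrime_forall_mem_iff_smul_mem (R := R) (hshift j).total
  have hfin₀ := (Module.Finite.fg_top (R := R) (M := B)
    ).finite_setOf_isPrime_forall_mem_iff_smul_mem (R := R) E
  refine (hfin₀.union (Set.finite_iUnion hfin)).subset ?_
  rintro P ⟨hP, n, b, hb⟩
  induction n using Finsupp.induction_add_single generalizing b with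
  | zero =>
    rw [Ideal.multiPow_zero, Submodule.top_smul] at hb
    exact Or.inl ⟨hP, b, trivial, hb⟩
  | step j n ih =>
    by_cases h : ∀ r : R, r • b ∈ Ideal.multiPow I n • E → r ∈ P
    · refine ih b fun r ↦ ⟨fun hr ↦ ?_, h r⟩
      have := (hb r).1 hr
      rw [Ideal.multiPow_add, mul_comm, mul_smul] at this
      exact Submodule.smul_le_right this
    · push Not at h
      obtain ⟨a, ha, haP⟩ := h
      refine Or.inr (Set.mem_iUnion.2 ⟨j, hP, MvPolynomial.monomial n (1 : R) ⊗ₜ[R] (a • b),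
        (IsMultiFiltration.multiPow I E).monomial_tmul_mem_total_iff.2 ha, fun r ↦ ?_⟩)
      rw [← TensorProduct.tmul_smul, (hshift j).monomial_tmul_mem_total_iff, ← mul_smul, ← hb,
        hP.mul_mem_iff_mem_or_mem, or_iff_left haP]

end Finiteness

section SmulLemmas

variable {R : Type*} [CommRing R]

lemma Submodule.smul_prod (J : Ideal R) {M N : Type*} [AddCommGroup M] [Module R M]
    [AddCommGroup N] [Module R N] (p : Submodule R M) (q : Submodule R N) :
    J • p.prod q = (J • p).prod (J • q) := by
  have (p : Submodule R M) (q : Submodule R N) :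
      p.prod q = p.map (LinearMap.inl R M N) ⊔ q.map (LinearMap.inr R M N) := by
    rw [← LinearMap.coprod_map_prod, LinearMap.coprod_inl_inr, Submodule.map_id]
  rw [this, this, smul_sup, map_smul'', map_smul'']

lemma Submodule.smul_pi_univ (J : Ideal R) {κ : Type*} [Finite κ] {M : κ → Type*}
    [∀ i, AddCommGroup (M i)] [∀ i, Module R (M i)] (p : ∀ i, Submodule R (M i)) :
    J • Submodule.pi Set.univ p = Submodule.pi Set.univ fun i ↦ J • p i := by
  classical
  simp_rw [← Submodule.iSup_map_single, Submodule.smul_iSup, map_smul'']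

/-- The elements of a module multiplied into `U` by some element outside of the prime `P`. -/
def Submodule.saturation {B : Type*} [AddCommGroup B] [Module R B] (U : Submodule R B)
    (P : Ideal R) [hP : P.IsPrime] : Submodule R B where
  carrier := {b | ∃ s ∉ P, s • b ∈ U}
  zero_mem' := ⟨1, hP.one_notMem, by simp⟩
  add_mem' := by
    rintro b c ⟨s, hs, hb⟩ ⟨t, ht, hc⟩
    refine ⟨s * t, fun h ↦ (hP.mem_or_mem h).elim hs ht, ?_⟩
    rw [smul_add]
    refine add_mem ?_ ?_
    · rw [mul_comm, mul_smul]
      exact U.smul_mem _ hb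
    · rw [mul_smul]
      exact U.smul_mem _ hc
  smul_mem' := by
    rintro r b ⟨s, hs, hb⟩
    exact ⟨s, hs, by rw [smul_comm]; exact U.smul_mem _ hb⟩

namespace Submodule

variable {B : Type*} [AddCommGroup B] [Module R B] (P : Ideal R) [hP : P.IsPrime]

lemma saturation_mono {U V : Submodule R B} (h : U ≤ V) : U.saturation P ≤ V.saturation P :=
  fun _ ⟨s, hs, hb⟩ ↦ ⟨s, hs, h hb⟩

lemma smul_saturation_le (J : Ideal R) (U : Submodule R B) :
    J • U.saturation P ≤ (J • U).saturation P :=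
  smul_le.2 fun a ha _ ⟨s, hs, hb⟩ ↦ ⟨s, hs, by rw [smul_comm]; exact smul_mem_smul ha hb⟩

end Submodule

end SmulLemmas

section Stability

open Filter

variable {R : Type*} [CommRing R] [IsNoetherianRing R] {ι : Type*} [Fintype ι] (I : ι → Ideal R)
  {B C : Type*} [AddCommGroup B] [Module R B] [Module.Finite R B]
  [AddCommGroup C] [Module R C]
  (β : B →ₗ[R] C) (L B' : Submodule R B) (C' : Submodule R C)

/-- The primes which are annihilators of classes of elements of `β⁻¹ (I ^ n • C')` modulo
`L ⊔ I ^ n • B'`. -/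
def primesMod (n : ι →₀ ℕ) : Set (Ideal R) :=
  {P | P.IsPrime ∧ ∃ b, β b ∈ Ideal.multiPow I n • C' ∧
    ∀ r : R, r ∈ P ↔ r • b ∈ L ⊔ Ideal.multiPow I n • B'}

lemma finite_iUnion_primesMod : (⋃ n, primesMod I β L B' C' n).Finite := by
  refine (finite_setOf_isPrime_forall_mem_iff_smul_mem_multiPow_smul I (B'.map L.mkQ)).subset ?_
  refine Set.iUnion_subset fun n ↦ ?_
  rintro P ⟨hP, b, -, hb⟩
  refine ⟨hP, n, L.mkQ b, fun r ↦ ?_⟩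
  rw [hb, ← map_smul, ← Submodule.map_smul'', ← Submodule.mem_comap, Submodule.comap_map_mkQ]

variable [Module.Finite R C]

lemma exists_mem_primesMod_add_iff (P : Ideal R) [hP : P.IsPrime] :
    ∃ (k : ι →₀ ℕ) (K D : Submodule R B), ∀ n,
      P ∈ primesMod I β L B' C' (k + n) ↔
        ¬ (K ≤ (L ⊔ Ideal.multiPow I (k + n) • B').saturation P ∧
          Ideal.multiPow I n • D ≤ (L ⊔ Ideal.multiPow I (k + n) • B').saturation P) := by
  obtain ⟨r, p, hp⟩ := Submodule.fg_iff_exists_fin_generating_family.1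
    ((isNoetherianRing_iff_ideal_fg R).1 ‹_› P)
  let γ : B →ₗ[R] C × (Fin r → B ⧸ L) := β.prod (LinearMap.pi fun i ↦ p i • L.mkQ)
  obtain ⟨k, D, hD⟩ := exists_comap_multiPow_smul_eq I γ
    (IsNoetherian.noetherian (C'.prod (Submodule.pi Set.univ fun _ ↦ B'.map L.mkQ)))
  refine ⟨k, LinearMap.ker γ, D, fun n ↦ ?_⟩
  rw [← sup_le_iff, ← hD]
  have hγ (b : B) (m : ι →₀ ℕ) : b ∈ (Ideal.multiPow I m •
      C'.prod (Submodule.pi Set.univ fun _ ↦ B'.map L.mkQ)).comap γ ↔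
      β b ∈ Ideal.multiPow I m • C' ∧ ∀ r ∈ P, r • b ∈ L ⊔ Ideal.multiPow I m • B' := by
    rw [Submodule.smul_prod, Submodule.smul_pi_univ, Submodule.mem_comap]
    refine and_congr Iff.rfl ?_
    have h1 (r : R) : r • L.mkQ b ∈ Ideal.multiPow I m • B'.map L.mkQ ↔
        r • b ∈ L ⊔ Ideal.multiPow I m • B' := by
      rw [← map_smul, ← Submodule.map_smul'', ← Submodule.mem_comap, Submodule.comap_map_mkQ]
    have h2 : (∀ r ∈ P, r • b ∈ L ⊔ Ideal.multiPow I m • B') ↔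
        P ≤ (L ⊔ Ideal.multiPow I m • B').comap (LinearMap.toSpanSingleton R B b) := by
      rfl
    rw [h2, ← hp, Submodule.span_le, Set.range_subset_iff]
    exact ⟨fun h i ↦ (h1 (p i)).1 (h i trivial), fun h i _ ↦ (h1 (p i)).2 (h i)⟩
  rw [SetLike.not_le_iff_exists]
  refine ⟨fun ⟨_, b, hb, h⟩ ↦ ⟨b, (hγ _ _).2 ⟨hb, fun r hr ↦ (h r).1 hr⟩, ?_⟩,
    fun ⟨b, hb, h⟩ ↦ ⟨hP, b, ((hγ _ _).1 hb).1, fun r ↦ ⟨((hγ _ _).1 hb).2 r, fun hr ↦ ?_⟩⟩⟩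
  · rintro ⟨s, hs, hsb⟩
    exact hs ((h s).2 hsb)
  · by_contra hrP
    exact h ⟨r, hrP, hr⟩

lemma eventually_mem_primesMod_or (P : Ideal R) [P.IsPrime] :
    (∀ᶠ n in atTop, P ∈ primesMod I β L B' C' n) ∨
      ∀ᶠ n in atTop, P ∉ primesMod I β L B' C' n := by
  obtain ⟨k, K, D, h⟩ := exists_mem_primesMod_add_iff I β L B' C' P
  have hanti (n m : ι →₀ ℕ) : L ⊔ Ideal.multiPow I (n + m) • B' ≤ L ⊔ Ideal.multiPow I n • B' := by
    rw [Ideal.multiPow_add, mul_comm, mul_smul]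
    exact sup_le_sup_left Submodule.smul_le_right _
  have key (Q : (ι →₀ ℕ) → Prop) (n₀ : ι →₀ ℕ) (hQ : ∀ m, Q (k + (n₀ + m))) :
      ∀ᶠ n in atTop, Q n := by
    filter_upwards [eventually_ge_atTop (k + n₀)] with n hn
    obtain ⟨m, rfl⟩ := exists_add_of_le hn
    rw [add_assoc]
    exact hQ m
  by_cases hK : ∀ n, K ≤ (L ⊔ Ideal.multiPow I (k + n) • B').saturation P
  · by_cases hD : ∃ n, Ideal.multiPow I n • D ≤
        (L ⊔ Ideal.multiPow I (k + n) • B').saturation P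
    · obtain ⟨n, hn⟩ := hD
      refine Or.inr (key _ n fun m ↦ (h _).not.2 (not_not.2 ⟨hK _, ?_⟩))
      rw [add_comm n, Ideal.multiPow_add, mul_smul]
      refine (smul_mono_right _ hn).trans ((Submodule.smul_saturation_le P _ _).trans
        (Submodule.saturation_mono P ?_))
      rw [Submodule.smul_sup, add_left_comm k m n, Ideal.multiPow_add I m, mul_smul]
      exact sup_le_sup Submodule.smul_le_right le_rfl
    · push Not at hD
      exact Or.inl (key _ 0 fun m ↦ (h _).2 fun hh ↦ hD _ hh.2)
  · push Not at hK
    obtain ⟨n, hn⟩ := hK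
    refine Or.inl (key _ n fun m ↦ (h _).2 fun hh ↦ hn (hh.1.trans ?_))
    rw [← add_assoc]
    exact Submodule.saturation_mono P (hanti _ _)

theorem exists_forall_primesMod_eq :
    ∃ k : ι →₀ ℕ, ∀ n m, k ≤ n → k ≤ m →
      primesMod I β L B' C' n = primesMod I β L B' C' m := by
  have hfin := finite_iUnion_primesMod I β L B' C'
  have h1 : ∀ᶠ k in atTop, ∀ P ∈ ⋃ n, primesMod I β L B' C' n,
      ∀ n m, k ≤ n → k ≤ m → (P ∈ primesMod I β L B' C' n ↔ P ∈ primesMod I β L B' C' m) := by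
    refine hfin.eventually_all.2 fun P hP ↦ ?_
    obtain ⟨-, hP, -⟩ := Set.mem_iUnion.1 hP
    rcases eventually_mem_primesMod_or I β L B' C' P with h | h
    · filter_upwards [eventually_forall_ge_atTop.2 h] with k hk n m hn hm
      exact iff_of_true (hk n hn) (hk m hm)
    · filter_upwards [eventually_forall_ge_atTop.2 h] with k hk n m hn hm
      exact iff_of_false (hk n hn) (hk m hm)
  obtain ⟨k, hk⟩ := h1.exists
  refine ⟨k, fun n m hn hm ↦ Set.ext fun P ↦ ?_⟩
  by_cases hP : P ∈ ⋃ n, primesMod I β L B' C' n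
  · exact hk P hP n m hn hm
  · exact iff_of_false (fun h ↦ hP (Set.mem_iUnion_of_mem n h))
      (fun h ↦ hP (Set.mem_iUnion_of_mem m h))

end Stability

section Hom

variable {R : Type*} [CommRing R] {N : Type*} [AddCommGroup N] [Module R N]

/-- The submodule of linear maps with range in a given submodule. -/
def Submodule.homsInto (F : Type*) [AddCommGroup F] [Module R F] (U : Submodule R N) :
    Submodule R (F →ₗ[R] N) where
  carrier := {f | ∀ x, f x ∈ U}
  add_mem' hf hg x := U.add_mem (hf x) (hg x)
  zero_mem' _ := U.zero_mem
  smul_mem' r _ hf x := U.smul_mem r (hf x)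

lemma Submodule.mem_homsInto {F : Type*} [AddCommGroup F] [Module R F] {U : Submodule R N}
    {f : F →ₗ[R] N} : f ∈ U.homsInto F ↔ ∀ x, f x ∈ U :=
  Iff.rfl

lemma Submodule.homsInto_smul (F : Type*) [AddCommGroup F] [Module R F] [Module.Finite R F]
    [Module.Projective R F] (J : Ideal R) (U : Submodule R N) :
    (J • U).homsInto F = J • U.homsInto F := by
  refine le_antisymm (fun f hf ↦ ?_) ?_
  · obtain ⟨b, p, s, -, -, hps⟩ := Module.Finite.exists_comp_eq_id_of_projective R F
    let Φ (j : Fin b) : N →ₗ[R] F →ₗ[R] N :=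
      LinearMap.smulRightₗ (LinearMap.proj j ∘ₗ s)
    have hΦ (j : Fin b) (y : N) (hy : y ∈ J • U) : Φ j y ∈ J • U.homsInto F := by
      have := Submodule.mem_map_of_mem (f := Φ j) hy
      rw [Submodule.map_smul''] at this
      refine Submodule.smul_mono le_rfl ?_ this
      rintro _ ⟨u, hu, rfl⟩ x
      exact U.smul_mem _ hu
    have hf' : f = ∑ j, Φ j (f (p (Pi.single j 1))) := by
      ext x
      have h : x = p (∑ j, s x j • Pi.single j (1 : R)) := by
        rw [← pi_eq_sum_univ' (s x)]
        exact (LinearMap.congr_fun hps x).symm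
      conv_lhs => rw [h]
      simp [Φ, LinearMap.sum_apply]
    rw [hf']
    exact sum_mem fun j _ ↦ hΦ j _ (hf _)
  · rw [Submodule.smul_le]
    exact fun r hr f hf x ↦ Submodule.smul_mem_smul hr (hf x)

end Hom

section FGModuleCat

universe u

variable {R : Type u} [CommRing R] [IsNoetherianRing R]

lemma FGModuleCat.surjective_of_epi {V W : FGModuleCat.{u} R} (f : V ⟶ W) [Epi f] :
    Function.Surjective f.hom.hom :=
  (ModuleCat.epi_iff_surjective _).1
    (inferInstanceAs (Epi ((forget₂ (FGModuleCat R) (ModuleCat R)).map f)))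

lemma FGModuleCat.projective_of_module_projective (V : FGModuleCat.{u} R)
    [Module.Projective R V] : Projective V where
  factors f e _ := by
    obtain ⟨g, hg⟩ := Module.projective_lifting_property e.hom.hom f.hom.hom
      (FGModuleCat.surjective_of_epi e)
    exact ⟨FGModuleCat.ofHom g, FGModuleCat.hom_ext hg⟩

lemma FGModuleCat.exists_epi_of_finite_free (V : FGModuleCat.{u} R) :
    ∃ (n : ℕ) (p : FGModuleCat.of R (Fin n → R) ⟶ V), Epi p := by
  obtain ⟨n, p, hp⟩ := Module.Finite.exists_fin' R V
  refine ⟨n, FGModuleCat.ofHom p, ?_⟩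
  apply (forget₂ (FGModuleCat R) (ModuleCat R)).epi_of_epi_map
  exact (ModuleCat.epi_iff_surjective _).2 hp

instance FGModuleCat.enoughProjectives : EnoughProjectives (FGModuleCat.{u} R) where
  presentation V := by
    obtain ⟨n, p, hp⟩ := FGModuleCat.exists_epi_of_finite_free V
    have : Module.Projective R (FGModuleCat.of R (Fin n → R)) :=
      inferInstanceAs (Module.Projective R (Fin n → R))
    exact ⟨{ p := _, projective := FGModuleCat.projective_of_module_projective _, f := p }⟩

instance FGModuleCat.preservesProjectiveObjects_forget₂ :
    (forget₂ (FGModuleCat.{u} R) (ModuleCat.{u} R)).PreservesProjectiveObjects where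
  projective_obj {V} hV := by
    obtain ⟨n, p, hp⟩ := FGModuleCat.exists_epi_of_finite_free V
    have : Module.Projective R ((forget₂ (FGModuleCat.{u} R) (ModuleCat.{u} R)).obj V) := by
      have : Module.Projective R (FGModuleCat.of R (Fin n → R)) :=
        inferInstanceAs (Module.Projective R (Fin n → R))
      refine Module.Projective.of_split (M := FGModuleCat.of R (Fin n → R))
        (P := V) (Projective.factorThru (𝟙 V) p).hom.hom p.hom.hom ?_
      rw [← FGModuleCat.hom_hom_comp, Projective.factorThru_comp]
      rfl
    exact ModuleCat.projective_of_categoryTheory_projective _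

/-- A finitely generated module over a Noetherian ring has a projective resolution by finitely
generated modules. -/
lemma ModuleCat.exists_projectiveResolution_finite
    (M : Type u) [AddCommGroup M] [Module R M] [Module.Finite R M] :
    ∃ P : ProjectiveResolution (ModuleCat.of R M), ∀ j, Module.Finite R (P.complex.X j) :=
  ⟨(forget₂ (FGModuleCat.{u} R) (ModuleCat.{u} R)).mapProjectiveResolution
    (ProjectiveResolution.of (FGModuleCat.of R M)), fun j ↦
      ((ProjectiveResolution.of (FGModuleCat.of R M)).complex.X j).property⟩

end FGModuleCat

section ExtAssociatedPrimes

universe u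

variable {R : Type u} [CommRing R] [IsNoetherianRing R]

lemma CategoryTheory.ShortComplex.mem_associatedPrimes_homology_iff
    (S : ShortComplex (ModuleCat.{u} R)) (P : Ideal R) :
    P ∈ associatedPrimes R S.homology ↔
      P.IsPrime ∧ ∃ x : S.X₂, S.g.hom x = 0 ∧ ∀ r : R, r ∈ P ↔ r • x ∈ LinearMap.range S.f.hom := by
  have h : associatedPrimes R S.homology = associatedPrimes R
      (LinearMap.ker S.g.hom ⧸ LinearMap.range S.moduleCatToCycles) :=
    LinearEquiv.AssociatedPrimes.eq S.moduleCatHomologyIso.toLinearEquiv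
  rw [h, AssociatedPrimes.mem_iff, isAssociatedPrime_iff]
  refine and_congr Iff.rfl ⟨?_, ?_⟩
  · rintro ⟨x, rfl⟩
    obtain ⟨x, rfl⟩ := Submodule.mkQ_surjective _ x
    refine ⟨x, x.2, fun r ↦ ?_⟩
    rw [Submodule.mem_colon_singleton, ← map_smul, Submodule.mem_bot, Submodule.mkQ_apply,
      Submodule.Quotient.mk_eq_zero]
    simp only [LinearMap.mem_range, Subtype.ext_iff]
    rfl
  · rintro ⟨x, hx, h⟩
    refine ⟨Submodule.mkQ _ ⟨x, hx⟩, ?_⟩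
    ext r
    rw [Submodule.mem_colon_singleton, ← map_smul, Submodule.mem_bot, Submodule.mkQ_apply,
      Submodule.Quotient.mk_eq_zero, h]
    simp only [LinearMap.mem_range, Subtype.ext_iff]
    rfl

lemma mem_associatedPrimes_ext_iff {X : ModuleCat.{u} R} (P : ProjectiveResolution X) (i : ℕ)
    (Y : ModuleCat.{u} R) (Q : Ideal R) :
    Q ∈ associatedPrimes R (((Ext R (ModuleCat R) i).obj (Opposite.op X)).obj Y) ↔
      Q.IsPrime ∧ ∃ f : P.complex.X i →ₗ[R] Y,
        f ∘ₗ (P.complex.d ((ComplexShape.up ℕ).next i) i).hom = 0 ∧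
        ∀ r : R, r ∈ Q ↔ ∃ g : P.complex.X ((ComplexShape.up ℕ).prev i) →ₗ[R] Y,
          g ∘ₗ (P.complex.d i ((ComplexShape.up ℕ).prev i)).hom = r • f := by
  rw [LinearEquiv.AssociatedPrimes.eq (P.isoExt (R := R) i Y).toLinearEquiv]
  refine (ShortComplex.mem_associatedPrimes_homology_iff
    ((P.complex.linearYonedaObj R Y).sc i) Q).trans (and_congr Iff.rfl ?_)
  constructor
  · rintro ⟨f, hf, h⟩
    refine ⟨f.hom, congr_arg ModuleCat.Hom.hom hf, fun r ↦ (h r).trans ⟨?_, ?_⟩⟩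
    · rintro ⟨g, hg⟩
      exact ⟨g.hom, congr_arg ModuleCat.Hom.hom hg⟩
    · rintro ⟨g, hg⟩
      exact ⟨ModuleCat.ofHom g, ModuleCat.hom_ext hg⟩
  · rintro ⟨f, hf, h⟩
    refine ⟨ModuleCat.ofHom f, ModuleCat.hom_ext hf, fun r ↦ (h r).trans ⟨?_, ?_⟩⟩
    · rintro ⟨g, hg⟩
      exact ⟨ModuleCat.ofHom g, ModuleCat.hom_ext hg⟩
    · rintro ⟨g, hg⟩
      exact ⟨g.hom, congr_arg ModuleCat.Hom.hom hg⟩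

end ExtAssociatedPrimes

section HomPrimes

variable {R : Type*} [CommRing R] {N : Type*} [AddCommGroup N] [Module R N]
  {F₀ F₁ F₂ : Type*} [AddCommGroup F₀] [Module R F₀] [AddCommGroup F₁] [Module R F₁]
  [AddCommGroup F₂] [Module R F₂]

lemma Submodule.mem_homsInto_iff_mkQ_comp_eq_zero {U : Submodule R N} {f : F₁ →ₗ[R] N} :
    f ∈ U.homsInto F₁ ↔ U.mkQ ∘ₗ f = 0 := by
  simp [mem_homsInto, LinearMap.ext_iff]

lemma Submodule.mem_range_lcomp_sup_homsInto_iff [Module.Projective R F₀] (d : F₁ →ₗ[R] F₀)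
    {U : Submodule R N} {f : F₁ →ₗ[R] N} :
    f ∈ LinearMap.range (d.lcomp R N) ⊔ U.homsInto F₁ ↔
      ∃ g : F₀ →ₗ[R] N ⧸ U, g ∘ₗ d = U.mkQ ∘ₗ f := by
  rw [Submodule.mem_sup]
  constructor
  · rintro ⟨_, ⟨g, rfl⟩, h, hh, rfl⟩
    refine ⟨U.mkQ ∘ₗ g, ?_⟩
    rw [LinearMap.comp_add, mem_homsInto_iff_mkQ_comp_eq_zero.1 hh, add_zero]
    rfl
  · rintro ⟨g, hg⟩
    obtain ⟨g, rfl⟩ := Module.projective_lifting_property U.mkQ g U.mkQ_surjective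
    refine ⟨_, ⟨g, rfl⟩, f - g ∘ₗ d, ?_, add_sub_cancel _ _⟩
    rw [mem_homsInto_iff_mkQ_comp_eq_zero, LinearMap.comp_sub, ← hg, LinearMap.comp_assoc, sub_self]

variable {ι : Type*} [Fintype ι] (I : ι → Ideal R)
  [Module.Finite R F₁] [Module.Finite R F₂] [Module.Projective R F₀]
  [Module.Projective R F₁] [Module.Projective R F₂]

lemma mem_primesMod_lcomp_iff (d₁ : F₁ →ₗ[R] F₀) (d₂ : F₂ →ₗ[R] F₁) (N' : Submodule R N)
    (n : ι →₀ ℕ) (P : Ideal R) :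
    P ∈ primesMod I (d₂.lcomp R N) (LinearMap.range (d₁.lcomp R N)) (N'.homsInto F₁)
        (N'.homsInto F₂) n ↔
      P.IsPrime ∧ ∃ f : F₁ →ₗ[R] N ⧸ (Ideal.multiPow I n • N'), f ∘ₗ d₂ = 0 ∧
        ∀ r : R, r ∈ P ↔ ∃ g : F₀ →ₗ[R] N ⧸ (Ideal.multiPow I n • N'), g ∘ₗ d₁ = r • f := by
  simp only [primesMod, Set.mem_ofPred_eq, ← Submodule.homsInto_smul,
    Submodule.mem_range_lcomp_sup_homsInto_iff, Submodule.mem_homsInto_iff_mkQ_comp_eq_zero,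
    LinearMap.comp_smul]
  refine and_congr Iff.rfl ⟨fun ⟨f, hf, h⟩ ↦ ⟨_ ∘ₗ f, hf, h⟩, fun ⟨f, hf, h⟩ ↦ ?_⟩
  obtain ⟨f, rfl⟩ := Module.projective_lifting_property (Submodule.mkQ _) f
    (Submodule.mkQ_surjective _)
  exact ⟨f, hf, h⟩

end HomPrimes

/-- **Katz–West theorem (Ext).** For ideals `I₁,…,I_t` of a commutative Noetherian ring
`R`, finitely generated modules `M`, `N`, a submodule `N' ⊆ N` and fixed `i`, the set
of associated primes of `Ext_R^i(M, N/(I₁^{n₁}⋯I_t^{n_t})N')` is the same for all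
`(n₁,…,n_t)` with all entries sufficiently large. -/
theorem katz_west_ext (R : Type) [CommRing R] [IsNoetherianRing R]
    (t : ℕ) (I : Fin t → Ideal R) (M N : Type) [AddCommGroup M] [Module R M]
    [Module.Finite R M] [AddCommGroup N] [Module R N] [Module.Finite R N]
    (N' : Submodule R N) (i : ℕ) :
    ∃ k : ℕ, ∀ n m : Fin t → ℕ, (∀ j, k ≤ n j) → (∀ j, k ≤ m j) →
      associatedPrimes R
        (((Ext R (ModuleCat R) i).obj (Opposite.op (ModuleCat.of R M))).obj
          (ModuleCat.of R (N ⧸ ((∏ j, I j ^ n j) • N')))) =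
      associatedPrimes R
        (((Ext R (ModuleCat R) i).obj (Opposite.op (ModuleCat.of R M))).obj
          (ModuleCat.of R (N ⧸ ((∏ j, I j ^ m j) • N')))) := by
  obtain ⟨P, hP⟩ := ModuleCat.exists_projectiveResolution_finite (R := R) M
  have (j : ℕ) : Module.Projective R (P.complex.X j) :=
    have := P.projective j
    ModuleCat.projective_of_module_projective _
  let d₁ := (P.complex.d i ((ComplexShape.up ℕ).prev i)).hom
  let d₂ := (P.complex.d ((ComplexShape.up ℕ).next i) i).hom
  obtain ⟨k, hk⟩ := exists_forall_primesMod_eq I (d₂.lcomp R N) (LinearMap.range (d₁.lcomp R N))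
    (N'.homsInto _) (N'.homsInto _)
  have key (n : Fin t → ℕ) : associatedPrimes R
      (((Ext R (ModuleCat R) i).obj (Opposite.op (ModuleCat.of R M))).obj
        (ModuleCat.of R (N ⧸ ((∏ j, I j ^ n j) • N')))) =
      primesMod I (d₂.lcomp R N) (LinearMap.range (d₁.lcomp R N))
        (N'.homsInto _) (N'.homsInto _) (Finsupp.equivFunOnFinite.symm n) :=
    Set.ext fun Q ↦ (mem_associatedPrimes_ext_iff P i _ Q).trans
      (mem_primesMod_lcomp_iff I d₁ d₂ N' (Finsupp.equivFunOnFinite.symm n) Q).symm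
  have hle (n : Fin t → ℕ) (hn : ∀ j, Finset.univ.sup k ≤ n j) :
      k ≤ Finsupp.equivFunOnFinite.symm n :=
    fun j ↦ (Finset.le_sup (Finset.mem_univ j)).trans (hn j)
  refine ⟨Finset.univ.sup k, fun n m hn hm ↦ ?_⟩
  rw [key, key, hk _ _ (hle n hn) (hle m hm)]
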